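/- Let k < ℓ with 2^k + 2^ℓ ≤ n and let λ ⊢_o n be such that R_k^k(λ) = R_k^ℓ(λ). Then f_k(f_ℓ(λ)) = f_ℓ(f_k(λ)) if and only if both R_k^k(f_ℓ(λ)) = f_{ℓ−k}(R_k^k(λ)) and the partition μ = R_k^k(λ) satisfies f_0(f_{ℓ−k}(μ)) = f_{ℓ−k}(f_0(μ)) (i.e. μ ∈ 𝒯_{0,ℓ−k}). -/

import Mathlib

namespace OddSym

open scoped Classical

/-- Remove one box from a row of size `p` (as multisets of parts). -/
def removeBox (lam : Multiset ℕ) (p : ℕ) : Multiset ℕ :=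
  if p ≤ 1 then lam.erase p else (p - 1) ::ₘ lam.erase p

lemma removeBox_sum_lt {lam : Multiset ℕ} {p : ℕ} (hp : p ∈ lam) (h0 : 0 < p) :
    (removeBox lam p).sum < lam.sum := by
  have h : p + (lam.erase p).sum = lam.sum := by
    conv_rhs => rw [← Multiset.cons_erase hp]
    simp [Multiset.sum_cons]
  unfold removeBox
  split
  · omega
  · simp only [Multiset.sum_cons]
    omega

/-- The number of standard Young tableaux of shape `lam`
(equivalently, the degree of the irreducible character of the symmetric
group labelled by `lam`), defined via the branching rule. -/
def degSYT (lam : Multiset ℕ) : ℕ :=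
  if _h : lam = 0 then 1
  else ∑ p ∈ (lam.toFinset.filter (fun p => 0 < p)).attach, degSYT (removeBox lam p.1)
termination_by lam.sum
decreasing_by
  have hp := p.2
  simp only [Finset.mem_filter, Multiset.mem_toFinset] at hp
  exact removeBox_sum_lt hp.1 hp.2

/-- `lam` is an odd partition: all parts positive and the number of standard
Young tableaux of shape `lam` (= the character degree) is odd. -/
def OddP (lam : Multiset ℕ) : Prop :=
  (∀ x ∈ lam, 0 < x) ∧ Odd (degSYT lam)

/-- The parts of `lam` sorted in weakly decreasing order. -/
def descList (lam : Multiset ℕ) : List ℕ :=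
  (lam.sort (· ≤ ·)).reverse

/-- The beta-set (set of beta-numbers) of `lam` with `m` beads:
`{ lam_i + (m - i) : 1 ≤ i ≤ m }` where `lam` is padded with zero parts. -/
def betaSet (lam : Multiset ℕ) (m : ℕ) : Finset ℕ :=
  (Finset.range m).image (fun i => (descList lam).getD i 0 + (m - 1 - i))

/-- `mu` is obtained from `lam` by removing an `e`-hook: in some beta-set of
`lam` a beta-number `x` is replaced by `x - e` (which is not a beta-number). -/
def IsHookRemoval (e : ℕ) (lam mu : Multiset ℕ) : Prop :=
  (∀ x ∈ lam, 0 < x) ∧ (∀ x ∈ mu, 0 < x) ∧ 0 < e ∧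
  ∃ m x, Multiset.card lam ≤ m ∧ Multiset.card mu ≤ m ∧
    x ∈ betaSet lam m ∧ e ≤ x ∧ x - e ∉ betaSet lam m ∧
    betaSet mu m = insert (x - e) ((betaSet lam m).erase x)

/-- The map `f_k` : for an odd partition `lam` with `2^k ≤ |lam|`, the unique
odd partition obtained from `lam` by removing a `2^k`-hook (junk value `0` if
no such partition exists). -/
noncomputable def fkOp (k : ℕ) (lam : Multiset ℕ) : Multiset ℕ :=
  if h : ∃ mu, IsHookRemoval (2 ^ k) lam mu ∧ OddP mu then h.choose else 0

/-- The partition encoded by a finite beta-set: each bead contributes a part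
equal to the number of gaps below it. -/
def partOfBeta (S : Finset ℕ) : Multiset ℕ :=
  (S.val.map (fun b => b - (S.filter (fun a => a < b)).card)).filter (fun p => 0 < p)

/-- The 2-quotient `(lam_0, lam_1)` of `lam`, computed from a beta-set with an
even number of beads via the two runners of the 2-abacus. -/
def quot2 (lam : Multiset ℕ) : Multiset ℕ × Multiset ℕ :=
  (partOfBeta (((betaSet lam (2 * Multiset.card lam)).filter (fun b => b % 2 = 0)).image
      (fun b => b / 2)),
   partOfBeta (((betaSet lam (2 * Multiset.card lam)).filter (fun b => b % 2 = 1)).image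
      (fun b => b / 2)))

/-- The `e`-core of `lam`: push all beads of an `e`-abacus configuration for
`lam` up as far as possible. -/
def coreP (e : ℕ) (lam : Multiset ℕ) : Multiset ℕ :=
  partOfBeta ((Finset.range (e * (Multiset.card lam + e))).filter
    (fun x => x / e <
      ((betaSet lam (Multiset.card lam + e)).filter (fun b => b % e = x % e)).card))

/-- Row `k` of the 2-quotient tower of `lam`: row 0 is `[lam]`, and row `k+1`
replaces each entry of row `k` by its 2-quotient pair. -/
def towerRow : ℕ → Multiset ℕ → List (Multiset ℕ)
  | 0, lam => [lam]
  | (k + 1), lam => (towerRow k lam).flatMap (fun mu => [(quot2 mu).1, (quot2 mu).2])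

/-- `R_k^j(lam)`: the component of row `k` of the 2-quotient tower of `lam`
from which a `2^(j-k)`-hook is removed in the passage from `lam` to `f_j(lam)`;
it is characterized by: row `k` for `f_j(lam)` is obtained from row `k` for
`lam` by replacing this component by its image under `f_(j-k)`. -/
noncomputable def Rcomp (k j : ℕ) (lam : Multiset ℕ) : Multiset ℕ :=
  if h : ∃ s, s < 2 ^ k ∧
      towerRow k (fkOp j lam) =
        (towerRow k lam).set s (fkOp (j - k) ((towerRow k lam).getD s 0))
  then (towerRow k lam).getD h.choose 0 else 0


/-- The parts of the partition with beta-set `S`, with one zero for every bead below the first gap. -/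
def paddedParts (S : Finset ℕ) : Multiset ℕ :=
  S.val.map (fun b => b - (S.filter (fun a => a < b)).card)

lemma partOfBeta_eq_filter (S : Finset ℕ) :
    partOfBeta S = (paddedParts S).filter (fun p => 0 < p) := rfl

lemma pos_of_mem_partOfBeta {S : Finset ℕ} {p : ℕ} (h : p ∈ partOfBeta S) : 0 < p :=
  (Multiset.mem_filter.1 h).2

lemma card_paddedParts (S : Finset ℕ) : Multiset.card (paddedParts S) = S.card := by
  simp [paddedParts]

lemma card_partOfBeta_le (S : Finset ℕ) : Multiset.card (partOfBeta S) ≤ S.card := by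
  rw [← card_paddedParts S, partOfBeta_eq_filter]
  exact Multiset.card_le_card (Multiset.filter_le _ _)

lemma paddedParts_insert {S : Finset ℕ} {b : ℕ} (h : ∀ a ∈ S, a < b) :
    paddedParts (insert b S) = (b - S.card) ::ₘ paddedParts S := by
  have hb : b ∉ S := fun hb => lt_irrefl _ (h b hb)
  unfold paddedParts
  rw [Finset.insert_val_of_notMem hb, Multiset.map_cons]
  congr 1
  · congr 2
    ext a
    simp only [Finset.mem_filter, Finset.mem_insert]
    constructor
    · rintro ⟨rfl | h1, h2⟩
      · omega
      · exact h1
    · exact fun h1 => ⟨Or.inr h1, h a h1⟩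
  · refine Multiset.map_congr rfl fun a ha => ?_
    congr 2
    ext c
    have := h a ha
    simp only [Finset.mem_filter, Finset.mem_insert]
    constructor
    · rintro ⟨rfl | h1, h2⟩
      · omega
      · exact ⟨h1, h2⟩
    · exact fun h1 => ⟨Or.inr h1.1, h1.2⟩

lemma card_le_of_forall_lt {S : Finset ℕ} {b : ℕ} (h : ∀ a ∈ S, a < b) : S.card ≤ b := by
  simpa using Finset.card_le_card (fun a ha => Finset.mem_range.2 (h a ha) : S ⊆ Finset.range b)

lemma sum_paddedParts (S : Finset ℕ) :
    (paddedParts S).sum + ∑ i ∈ Finset.range S.card, i = ∑ b ∈ S, b := by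
  induction S using Finset.induction_on_max with
  | empty => simp [paddedParts]
  | insert b S h ih =>
    have hb : b ∉ S := fun hb => lt_irrefl _ (h b hb)
    have := card_le_of_forall_lt h
    rw [paddedParts_insert h, Finset.card_insert_of_notMem hb, Finset.sum_range_succ,
      Finset.sum_insert hb, Multiset.sum_cons]
    omega

lemma paddedParts_eq_add (S : Finset ℕ) :
    paddedParts S =
      partOfBeta S + Multiset.replicate (S.card - Multiset.card (partOfBeta S)) 0 := by
  have h := Multiset.filter_add_not (fun p => 0 < p) (paddedParts S)
  have h2 : (paddedParts S).filter (fun p => ¬ 0 < p) =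
      Multiset.replicate (S.card - Multiset.card (partOfBeta S)) 0 := by
    rw [Multiset.eq_replicate]
    constructor
    · have := congrArg Multiset.card h
      rw [Multiset.card_add, card_paddedParts] at this
      rw [partOfBeta_eq_filter]
      omega
    · intro b hb
      have := (Multiset.mem_filter.1 hb).2
      omega
  rw [← h2, partOfBeta_eq_filter, h]

lemma sum_partOfBeta (S : Finset ℕ) :
    (partOfBeta S).sum + ∑ i ∈ Finset.range S.card, i = ∑ b ∈ S, b := by
  have h := sum_paddedParts S
  rw [paddedParts_eq_add S] at h
  simpa using h

lemma le_of_mem_paddedParts {S : Finset ℕ} {b p : ℕ} (h : ∀ a ∈ S, a < b)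
    (hp : p ∈ paddedParts S) : p ≤ b - S.card := by
  obtain ⟨a, ha, rfl⟩ := Multiset.mem_map.1 hp
  have ha' : a ∈ S := ha
  have h1 : S ⊆ (S.filter (fun c => c < a)) ∪ Finset.Ico a b := by
    intro c hc
    have := h c hc
    simp only [Finset.mem_union, Finset.mem_filter, Finset.mem_Ico]
    by_cases hca : c < a
    · exact Or.inl ⟨hc, hca⟩
    · exact Or.inr ⟨by omega, this⟩
  have h2 := (Finset.card_le_card h1).trans (Finset.card_union_le _ _)
  rw [Nat.card_Ico] at h2
  have := h a ha'
  omega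

lemma paddedParts_injective {S T : Finset ℕ} (h : paddedParts S = paddedParts T) : S = T := by
  induction S using Finset.induction_on_max generalizing T with
  | empty =>
    have := congrArg Multiset.card h
    rw [card_paddedParts, card_paddedParts] at this
    exact (Finset.card_eq_zero.1 this.symm).symm
  | insert b S hS ih =>
    have hb : b ∉ S := fun hb => lt_irrefl _ (hS b hb)
    have hcard := congrArg Multiset.card h
    rw [card_paddedParts, card_paddedParts, Finset.card_insert_of_notMem hb] at hcard
    have hne : T.Nonempty := Finset.card_pos.1 (by omega)
    set c := T.max' hne with hc
    have hcT : c ∈ T := T.max'_mem hne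
    have hlt : ∀ a ∈ T.erase c, a < c := fun a ha => T.lt_max'_of_mem_erase_max' hne ha
    have hTins : insert c (T.erase c) = T := Finset.insert_erase hcT
    have hTc : (T.erase c).card = S.card := by rw [Finset.card_erase_of_mem hcT]; omega
    rw [← hTins, paddedParts_insert hS, paddedParts_insert hlt, hTc] at h
    have h1 : S.card ≤ b := card_le_of_forall_lt hS
    have h2 : S.card ≤ c := hTc ▸ card_le_of_forall_lt hlt
    have hle1 : b - S.card ≤ c - S.card := by
      have : b - S.card ∈ (c - S.card) ::ₘ paddedParts (T.erase c) := h ▸ Multiset.mem_cons_self _ _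
      rcases Multiset.mem_cons.1 this with h3 | h3
      · exact h3.le
      · exact (le_of_mem_paddedParts hlt h3).trans_eq (by rw [hTc])
    have hle2 : c - S.card ≤ b - S.card := by
      have : c - S.card ∈ (b - S.card) ::ₘ paddedParts S := h ▸ Multiset.mem_cons_self _ _
      rcases Multiset.mem_cons.1 this with h3 | h3
      · exact h3.le
      · exact le_of_mem_paddedParts hS h3
    have hbc : b = c := by omega
    rw [hbc, Multiset.cons_inj_right] at h
    rw [← hTins, ih h, hbc]

lemma partOfBeta_injective {S T : Finset ℕ} (hc : S.card = T.card)
    (h : partOfBeta S = partOfBeta T) : S = T := by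
  apply paddedParts_injective
  rw [paddedParts_eq_add, paddedParts_eq_add T, h, hc]

/-- The beta-set of the same partition with one more bead. -/
def shift (S : Finset ℕ) : Finset ℕ := insert 0 (S.image Nat.succ)

lemma zero_mem_shift (S : Finset ℕ) : 0 ∈ shift S := Finset.mem_insert_self _ _

lemma succ_mem_shift {S : Finset ℕ} {x : ℕ} : x + 1 ∈ shift S ↔ x ∈ S := by
  simp [shift]

lemma card_shift (S : Finset ℕ) : (shift S).card = S.card + 1 := by
  rw [shift, Finset.card_insert_of_notMem (by simp),
    Finset.card_image_of_injective _ Nat.succ_injective]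

lemma shift_insert (S : Finset ℕ) (b : ℕ) : shift (insert b S) = insert (b + 1) (shift S) := by
  ext (_ | x)
  · simp [shift]
  · simp [shift]

lemma partOfBeta_shift (S : Finset ℕ) : partOfBeta (shift S) = partOfBeta S := by
  have : paddedParts (shift S) = 0 ::ₘ paddedParts S := by
    induction S using Finset.induction_on_max with
    | empty => simp [paddedParts, shift]
    | insert b S h ih =>
      have h' : ∀ a ∈ shift S, a < b + 1 := by
        rintro (_ | a) ha
        · omega
        · have := h a (succ_mem_shift.1 ha)
          omega
      rw [shift_insert, paddedParts_insert h', paddedParts_insert h, ih, card_shift,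
        Multiset.cons_swap, Nat.add_sub_add_right]
  rw [partOfBeta_eq_filter, this, Multiset.filter_cons_of_neg _ (by simp), partOfBeta_eq_filter]

lemma partOfBeta_shift_iterate (S : Finset ℕ) (j : ℕ) : partOfBeta (shift^[j] S) = partOfBeta S := by
  induction j with
  | zero => rfl
  | succ j ih => rw [Function.iterate_succ_apply', partOfBeta_shift, ih]

lemma card_shift_iterate (S : Finset ℕ) (j : ℕ) : (shift^[j] S).card = S.card + j := by
  induction j with
  | zero => rfl
  | succ j ih => rw [Function.iterate_succ_apply', card_shift, ih]; rfl

lemma eq_shift_iterate {S T : Finset ℕ} {j : ℕ} (h : partOfBeta S = partOfBeta T)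
    (hc : T.card = S.card + j) : T = shift^[j] S :=
  partOfBeta_injective (by rw [hc, card_shift_iterate]) (by rw [partOfBeta_shift_iterate, h])

lemma descList_sorted (lam : Multiset ℕ) : (descList lam).Pairwise (· ≥ ·) := by
  unfold descList
  rw [List.pairwise_reverse]
  exact Multiset.pairwise_sort lam (· ≤ ·)

lemma coe_descList (lam : Multiset ℕ) : (descList lam : Multiset ℕ) = lam := by
  unfold descList
  rw [Multiset.coe_reverse, Multiset.sort_eq]

lemma getD_descList_anti (lam : Multiset ℕ) {i j : ℕ} (h : i ≤ j) :
    (descList lam).getD j 0 ≤ (descList lam).getD i 0 := by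
  by_cases hj : j < (descList lam).length
  · rw [List.getD_eq_getElem _ _ hj, List.getD_eq_getElem _ _ (h.trans_lt hj)]
    rcases h.eq_or_lt with rfl | h
    · exact le_rfl
    · exact List.pairwise_iff_getElem.1 (descList_sorted lam) i j (h.trans hj) hj h
  · rw [List.getD_eq_default _ _ (by omega)]
    exact Nat.zero_le _

lemma betaSet_bead_lt (lam : Multiset ℕ) {m i j : ℕ} (h : i < j) (hj : j < m) :
    (descList lam).getD j 0 + (m - 1 - j) < (descList lam).getD i 0 + (m - 1 - i) := by
  have := getD_descList_anti lam h.le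
  omega

lemma betaSet_injOn (lam : Multiset ℕ) (m : ℕ) :
    Set.InjOn (fun i => (descList lam).getD i 0 + (m - 1 - i)) (Finset.range m) := by
  intro i hi j hj hij
  simp only [Finset.coe_range, Set.mem_Iio] at hi hj
  simp only at hij
  rcases lt_trichotomy i j with h | h | h
  · have := betaSet_bead_lt lam h hj
    omega
  · exact h
  · have := betaSet_bead_lt lam h hi
    omega

lemma card_betaSet (lam : Multiset ℕ) (m : ℕ) : (betaSet lam m).card = m := by
  rw [betaSet, Finset.card_image_of_injOn (betaSet_injOn lam m), Finset.card_range]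

lemma paddedParts_betaSet (lam : Multiset ℕ) (m : ℕ) :
    paddedParts (betaSet lam m) =
      (Multiset.range m).map (fun i => (descList lam).getD i 0) := by
  have h1 : (betaSet lam m).val =
      (Multiset.range m).map (fun i => (descList lam).getD i 0 + (m - 1 - i)) := by
    rw [betaSet, Finset.image_val_of_injOn (betaSet_injOn lam m)]
    rfl
  rw [paddedParts, h1, Multiset.map_map]
  refine Multiset.map_congr rfl fun i hi => ?_
  rw [Multiset.mem_range] at hi
  have h2 : (betaSet lam m).filter (fun a => a < (descList lam).getD i 0 + (m - 1 - i)) =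
      (Finset.Ico (i + 1) m).image (fun i => (descList lam).getD i 0 + (m - 1 - i)) := by
    ext a
    simp only [betaSet, Finset.mem_filter, Finset.mem_image, Finset.mem_range, Finset.mem_Ico]
    constructor
    · rintro ⟨⟨j, hj, rfl⟩, hlt⟩
      refine ⟨j, ⟨?_, hj⟩, rfl⟩
      by_contra hji
      rcases Nat.lt_or_ge j i with h | h
      · have := betaSet_bead_lt lam h hi
        omega
      · have : j = i := by omega
        subst this
        omega
    · rintro ⟨j, ⟨hij, hj⟩, rfl⟩
      exact ⟨⟨j, hj, rfl⟩, betaSet_bead_lt lam (by omega) hj⟩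
  have h3 := betaSet_injOn lam m
  simp only [Function.comp_apply]
  rw [h2, Finset.card_image_of_injOn
    (h3.mono (by intro j; simp only [Finset.coe_Ico, Set.mem_Ico, Finset.coe_range, Set.mem_Iio]; omega)),
    Nat.card_Ico]
  omega

lemma map_range_getD (L : List ℕ) (j : ℕ) :
    (List.range (L.length + j)).map (fun i => L.getD i 0) = L ++ List.replicate j 0 := by
  refine List.ext_getElem (by simp) fun i h1 h2 => ?_
  rw [List.getElem_map, List.getElem_range, List.getElem_append]
  split
  · exact List.getD_eq_getElem _ _ _
  · rw [List.getD_eq_default _ _ (by omega), List.getElem_replicate]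

lemma partOfBeta_betaSet {lam : Multiset ℕ} {m : ℕ} (hpos : ∀ x ∈ lam, 0 < x)
    (hm : Multiset.card lam ≤ m) : partOfBeta (betaSet lam m) = lam := by
  obtain ⟨j, rfl⟩ := Nat.exists_eq_add_of_le hm
  have hlen : (descList lam).length = Multiset.card lam := by
    conv_rhs => rw [← coe_descList lam]
    rfl
  have h : (Multiset.range (Multiset.card lam + j)).map (fun i => (descList lam).getD i 0) =
      lam + Multiset.replicate j 0 := by
    have := congrArg (fun L : List ℕ => (L : Multiset ℕ)) (map_range_getD (descList lam) j)
    simp only [← Multiset.coe_add, coe_descList, hlen] at this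
    exact this
  rw [partOfBeta_eq_filter, paddedParts_betaSet, h, Multiset.filter_add,
    Multiset.filter_eq_self.2 hpos, Multiset.filter_eq_nil.2, add_zero]
  intro a ha
  simp [Multiset.eq_of_mem_replicate ha]

lemma betaSet_partOfBeta (S : Finset ℕ) : betaSet (partOfBeta S) S.card = S :=
  partOfBeta_injective (card_betaSet _ _)
    (partOfBeta_betaSet (fun _ => pos_of_mem_partOfBeta) (card_partOfBeta_le S))

/-- The bead `x` of `S` can be moved down by `e` places. -/
def CanMove (e : ℕ) (S : Finset ℕ) (x : ℕ) : Prop := x ∈ S ∧ e ≤ x ∧ x - e ∉ S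

/-- Move the bead `x` of `S` down by `e` places. -/
def moveBead (e x : ℕ) (S : Finset ℕ) : Finset ℕ := insert (x - e) (S.erase x)

lemma mem_moveBead {e x y : ℕ} {S : Finset ℕ} :
    y ∈ moveBead e x S ↔ y = x - e ∨ y ≠ x ∧ y ∈ S := by
  simp [moveBead]

lemma CanMove.sub_notMem_erase {e x : ℕ} {S : Finset ℕ} (h : CanMove e S x) :
    x - e ∉ S.erase x := fun h1 => h.2.2 (Finset.mem_of_mem_erase h1)

lemma CanMove.pos {e x : ℕ} {S : Finset ℕ} (h : CanMove e S x) : 0 < e := by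
  rcases Nat.eq_zero_or_pos e with rfl | h1
  · exact absurd h.1 h.2.2
  · exact h1

lemma CanMove.card_moveBead {e x : ℕ} {S : Finset ℕ} (h : CanMove e S x) :
    (moveBead e x S).card = S.card := by
  have := Finset.card_pos.2 ⟨x, h.1⟩
  rw [moveBead, Finset.card_insert_of_notMem h.sub_notMem_erase, Finset.card_erase_of_mem h.1]
  omega

lemma CanMove.sum_partOfBeta_moveBead {e x : ℕ} {S : Finset ℕ} (h : CanMove e S x) :
    (partOfBeta (moveBead e x S)).sum + e = (partOfBeta S).sum := by
  have h1 := sum_partOfBeta S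
  have h2 := sum_partOfBeta (moveBead e x S)
  rw [h.card_moveBead, moveBead, Finset.sum_insert h.sub_notMem_erase] at h2
  have h3 := Finset.add_sum_erase S (fun b => b) h.1
  have := h.2.1
  rw [← moveBead] at h2
  omega

/-- The number of elements of `S` below `x`. -/
def rank (S : Finset ℕ) (x : ℕ) : ℕ := (S.filter (fun a => a < x)).card

lemma rank_mono (S : Finset ℕ) {x y : ℕ} (h : x ≤ y) : rank S x ≤ rank S y :=
  Finset.card_le_card fun a ha => by
    simp only [Finset.mem_filter] at ha ⊢
    exact ⟨ha.1, ha.2.trans_le h⟩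

lemma rank_succ_of_mem {S : Finset ℕ} {x : ℕ} (h : x ∈ S) : rank S (x + 1) = rank S x + 1 := by
  have : S.filter (fun a => a < x + 1) = insert x (S.filter (fun a => a < x)) := by
    ext a
    simp only [Finset.mem_filter, Finset.mem_insert]
    constructor
    · rintro ⟨h1, h2⟩
      by_cases hax : a = x
      · exact Or.inl hax
      · exact Or.inr ⟨h1, by omega⟩
    · rintro (rfl | h1)
      · exact ⟨h, by omega⟩
      · exact ⟨h1.1, by omega⟩
  rw [rank, this, Finset.card_insert_of_notMem (by simp), rank]

lemma rank_succ_of_notMem {S : Finset ℕ} {x : ℕ} (h : x ∉ S) : rank S (x + 1) = rank S x := by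
  unfold rank
  congr 1
  ext a
  simp only [Finset.mem_filter]
  constructor
  · rintro ⟨h1, h2⟩
    have : a ≠ x := fun h3 => h (h3 ▸ h1)
    exact ⟨h1, by omega⟩
  · rintro ⟨h1, h2⟩
    exact ⟨h1, by omega⟩

lemma rank_le (S : Finset ℕ) (x : ℕ) : rank S x ≤ x := by
  induction x with
  | zero => simp [rank]
  | succ x ih =>
    by_cases h : x ∈ S
    · rw [rank_succ_of_mem h]; omega
    · rw [rank_succ_of_notMem h]; omega

lemma sub_rank_mono (S : Finset ℕ) {x y : ℕ} (h : x ≤ y) : x - rank S x ≤ y - rank S y := by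
  induction y, h using Nat.le_induction with
  | base => exact le_rfl
  | succ y hy ih =>
    have := rank_le S y
    by_cases h : y ∈ S
    · rw [rank_succ_of_mem h]; omega
    · rw [rank_succ_of_notMem h]; omega

lemma CanMove.rank_lt {x : ℕ} {S : Finset ℕ} (h : CanMove 1 S x) : rank S x < x := by
  obtain ⟨h1, h2, h3⟩ := h
  obtain ⟨y, rfl⟩ : ∃ y, x = y + 1 := ⟨x - 1, by omega⟩
  rw [Nat.add_sub_cancel] at h3
  rw [rank_succ_of_notMem h3]
  have := rank_le S y
  omega

lemma CanMove.paddedParts_eq {x : ℕ} {S : Finset ℕ} (h : CanMove 1 S x) :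
    ∃ P, paddedParts S = (x - rank S x) ::ₘ P ∧
      paddedParts (moveBead 1 x S) = (x - rank S x - 1) ::ₘ P := by
  refine ⟨(S.erase x).val.map (fun b => b - rank S b), ?_, ?_⟩
  · conv_lhs => rw [← Finset.insert_erase h.1]
    rw [paddedParts, Finset.insert_val_of_notMem (Finset.notMem_erase _ _), Multiset.map_cons,
      Finset.insert_erase h.1]
    rfl
  · have hx := h.2.1
    have hr : ∀ b ∈ insert (x - 1) (S.erase x),
        (moveBead 1 x S).filter (fun a => a < b) =
          if b ≤ x then (S.filter (fun a => a < b)) else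
            insert (x - 1) ((S.filter (fun a => a < b)).erase x) := by
      intro b hb
      ext a
      have := h.2.2
      split <;> rename_i hbx <;>
      simp only [Finset.mem_filter, mem_moveBead, Finset.mem_insert, Finset.mem_erase] at hb ⊢
      · constructor
        · rintro ⟨rfl | h1, h2⟩
          · rcases hb with rfl | ⟨h3, h4⟩ <;> omega
          · exact ⟨h1.2, h2⟩
        · rintro ⟨h1, h2⟩
          exact ⟨Or.inr ⟨by omega, h1⟩, h2⟩
      · constructor
        · rintro ⟨rfl | h1, h2⟩
          · exact Or.inl rfl
          · exact Or.inr ⟨h1.1, h1.2, h2⟩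
        · rintro (rfl | h1)
          · exact ⟨Or.inl rfl, by omega⟩
          · exact ⟨Or.inr ⟨h1.1, h1.2.1⟩, h1.2.2⟩
    have hr2 : ∀ b ∈ insert (x - 1) (S.erase x),
        ((moveBead 1 x S).filter (fun a => a < b)).card = rank S b := by
      intro b hb
      rw [hr b hb]
      split
      · rfl
      · have hxm : x ∈ S.filter (fun a => a < b) := by
          simp only [Finset.mem_filter]
          exact ⟨h.1, by omega⟩
        rw [Finset.card_insert_of_notMem, Finset.card_erase_of_mem hxm]
        · have := Finset.card_pos.2 ⟨x, hxm⟩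
          unfold rank
          omega
        · intro h1
          exact h.2.2 (Finset.mem_filter.1 (Finset.mem_of_mem_erase h1)).1
    have h1 : (moveBead 1 x S).val = (x - 1) ::ₘ (S.erase x).val := by
      rw [moveBead, Finset.insert_val_of_notMem h.sub_notMem_erase]
    rw [paddedParts, h1, Multiset.map_cons, hr2 _ (Finset.mem_insert_self _ _)]
    have h2 : rank S x = rank S (x - 1) := by
      obtain ⟨y, rfl⟩ : ∃ y, x = y + 1 := ⟨x - 1, by omega⟩
      exact rank_succ_of_notMem (x := y) h.2.2
    congr 1
    · omega
    · refine Multiset.map_congr rfl fun b hb => ?_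
      rw [hr2 b (Finset.mem_insert_of_mem hb)]

lemma CanMove.partOfBeta_moveBead_one {x : ℕ} {S : Finset ℕ} (h : CanMove 1 S x) :
    x - rank S x ∈ partOfBeta S ∧
      partOfBeta (moveBead 1 x S) = removeBox (partOfBeta S) (x - rank S x) := by
  obtain ⟨P, h1, h2⟩ := h.paddedParts_eq
  have h3 := h.rank_lt
  rw [partOfBeta_eq_filter, partOfBeta_eq_filter, h1, h2,
    Multiset.filter_cons_of_pos _ (by omega), removeBox, Multiset.erase_cons_head]
  refine ⟨Multiset.mem_cons_self _ _, ?_⟩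
  split
  · rw [Multiset.filter_cons_of_neg _ (by omega)]
  · rw [Multiset.filter_cons_of_pos _ (by omega)]

lemma exists_canMove_one {S : Finset ℕ} {p : ℕ} (h : p ∈ partOfBeta S) :
    ∃ x, CanMove 1 S x ∧ x - rank S x = p := by
  have hp := pos_of_mem_partOfBeta h
  obtain ⟨b, hb, hbp⟩ := Multiset.mem_map.1 (Multiset.mem_filter.1 h).1
  have hex : ∃ x, x ∈ S ∧ x - rank S x = p := ⟨b, hb, hbp⟩
  obtain ⟨h1, h2⟩ := Nat.find_spec hex
  refine ⟨Nat.find hex, ⟨h1, ?_, fun h3 => ?_⟩, h2⟩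
  · omega
  · set x := Nat.find hex with hx
    have hlt : x - 1 < Nat.find hex := by omega
    refine Nat.find_min hex hlt ⟨h3, ?_⟩
    have h4 := rank_succ_of_mem h3
    rw [show x - 1 + 1 = x by omega] at h4
    omega

lemma CanMove.sub_rank_injective {x y : ℕ} {S : Finset ℕ} (hx : CanMove 1 S x)
    (hy : CanMove 1 S y) (h : x - rank S x = y - rank S y) : x = y := by
  have key : ∀ {x y : ℕ}, CanMove 1 S x → CanMove 1 S y → x < y →
      x - rank S x < y - rank S y := by
    intro x y hx hy hxy
    obtain ⟨z, rfl⟩ : ∃ z, y = z + 1 := ⟨y - 1, by omega⟩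
    have h1 := sub_rank_mono S (show x ≤ z by omega)
    rw [rank_succ_of_notMem (x := z) hy.2.2]
    have := rank_le S z
    omega
  rcases lt_trichotomy x y with h1 | h1 | h1
  · have := key hx hy h1; omega
  · exact h1
  · have := key hy hx h1; omega

lemma degSYT_partOfBeta {S : Finset ℕ} (h : partOfBeta S ≠ 0) :
    degSYT (partOfBeta S) =
      ∑ x ∈ S.filter (CanMove 1 S), degSYT (partOfBeta (moveBead 1 x S)) := by
  rw [degSYT, dif_neg h,
    Finset.sum_attach _ (fun p => degSYT (removeBox (partOfBeta S) p))]
  symm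
  refine Finset.sum_bij (fun x _ => x - rank S x) ?_ ?_ ?_ ?_
  · intro x hx
    have hx := (Finset.mem_filter.1 hx).2
    have h1 := hx.partOfBeta_moveBead_one.1
    simp only [Finset.mem_filter, Multiset.mem_toFinset]
    exact ⟨h1, pos_of_mem_partOfBeta h1⟩
  · intro x hx y hy hxy
    exact (Finset.mem_filter.1 hx).2.sub_rank_injective (Finset.mem_filter.1 hy).2 hxy
  · intro p hp
    simp only [Finset.mem_filter, Multiset.mem_toFinset] at hp
    obtain ⟨x, hx, hxp⟩ := exists_canMove_one hp.1
    exact ⟨x, Finset.mem_filter.2 ⟨hx.1, hx⟩, hxp⟩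
  · intro x hx
    rw [(Finset.mem_filter.1 hx).2.partOfBeta_moveBead_one.2]

/-- The degree of the partition with beta-set `S`, modulo two. -/
def degParity (S : Finset ℕ) : ZMod 2 := (degSYT (partOfBeta S) : ZMod 2)

/-- The operator summing over all ways of moving one bead down by `e` places. -/
noncomputable def lower (e : ℕ) (g : Finset ℕ → ZMod 2) (S : Finset ℕ) : ZMod 2 :=
  ∑ x ∈ S.filter (CanMove e S), g (moveBead e x S)

lemma moveBead_comm {e x y : ℕ} {S : Finset ℕ} (hx : y ≠ x - e) (hy : x ≠ y - e) :
    moveBead e x (moveBead e y S) = moveBead e y (moveBead e x S) := by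
  ext a
  simp only [mem_moveBead]
  by_cases h1 : a = x - e
  · subst h1
    simp [hx.symm]
  · by_cases h2 : a = y - e
    · subst h2
      simp [hy.symm]
    · simp only [h1, h2, false_or]
      tauto

lemma lower_lower {e : ℕ} (he : 0 < e) (g : Finset ℕ → ZMod 2) (S : Finset ℕ) :
    lower e (lower e g) S = lower (2 * e) g S := by
  unfold lower
  rw [Finset.sum_sigma']
  set A := (S.filter (CanMove e S)).sigma
    (fun x => (moveBead e x S).filter (CanMove e (moveBead e x S))) with hA
  have memA : ∀ q : (_ : ℕ) × ℕ, q ∈ A ↔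
      CanMove e S q.1 ∧ CanMove e (moveBead e q.1 S) q.2 := by
    intro q
    simp only [hA, Finset.mem_sigma, Finset.mem_filter]
    exact ⟨fun h => ⟨h.1.2, h.2.2⟩, fun h => ⟨⟨h.1.1, h.1⟩, h.2.1, h.2⟩⟩
  rw [← Finset.sum_filter_add_sum_filter_not A (fun q => q.2 ≠ q.1 - e ∧ q.2 ≠ q.1 + e)]
  have h1 : ∑ q ∈ A.filter (fun q => q.2 ≠ q.1 - e ∧ q.2 ≠ q.1 + e),
      g (moveBead e q.2 (moveBead e q.1 S)) = 0 := by
    refine Finset.sum_involution (fun q _ => ⟨q.2, q.1⟩) ?_ ?_ ?_ ?_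
    · rintro ⟨x, y⟩ hq
      simp only [Finset.mem_filter, memA] at hq
      obtain ⟨⟨⟨h1, h2, h3⟩, h4, h5, h6⟩, h7, h8⟩ := hq
      rw [moveBead_comm (x := y) (y := x) (by omega) (by omega)]
      exact CharTwo.add_self_eq_zero _
    · rintro ⟨x, y⟩ hq - heq
      simp only [Finset.mem_filter, memA] at hq
      obtain ⟨⟨⟨h1, h2, h3⟩, h4, h5, h6⟩, h7, h8⟩ := hq
      simp only [Sigma.mk.injEq] at heq
      obtain ⟨rfl, -⟩ := heq
      simp only [mem_moveBead] at h4
      omega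
    · rintro ⟨x, y⟩ hq
      simp only [Finset.mem_filter, memA, CanMove, mem_moveBead] at hq ⊢
      obtain ⟨⟨⟨h1, h2, h3⟩, h4, h5, h6⟩, h7, h8⟩ := hq
      push Not at h6
      have h9 : y ≠ x ∧ y ∈ S := by tauto
      refine ⟨⟨⟨h9.2, h5, h6.2 (by omega)⟩, Or.inr ⟨h9.1.symm, h1⟩, h2, ?_⟩, by omega, by omega⟩
      rintro (h10 | h10)
      · omega
      · exact h3 h10.2
    · rintro ⟨x, y⟩ hq
      rfl
  rw [h1, zero_add]
  symm
  refine Finset.sum_bij (fun y _ => if y - e ∈ S then ⟨y - e, y⟩ else ⟨y, y - e⟩) ?_ ?_ ?_ ?_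
  · intro y hy
    obtain ⟨h1, h2, h3⟩ := (Finset.mem_filter.1 hy).2
    split <;> rename_i h4 <;> simp only [Finset.mem_filter, memA, CanMove, mem_moveBead]
    · have h5 : y - e - e = y - 2 * e := by omega
      rw [h5]
      refine ⟨⟨⟨h4, by omega, h3⟩, Or.inr ⟨by omega, h1⟩, by omega, ?_⟩, by omega⟩
      omega
    · have h5 : y - e - e = y - 2 * e := by omega
      rw [h5]
      refine ⟨⟨⟨h1, by omega, h4⟩, Or.inl trivial, by omega, ?_⟩, by omega⟩
      rintro (h6 | h6)
      · omega
      · exact h3 h6.2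
  · intro y hy z hz hyz
    obtain ⟨h1, h2, h3⟩ := (Finset.mem_filter.1 hy).2
    obtain ⟨h4, h5, h6⟩ := (Finset.mem_filter.1 hz).2
    split at hyz <;> split at hyz <;> simp only [Sigma.mk.injEq, heq_eq_eq] at hyz <;> omega
  · rintro ⟨x, y⟩ hq
    simp only [Finset.mem_filter, memA, CanMove, mem_moveBead] at hq
    obtain ⟨⟨⟨h1, h2, h3⟩, h4, h5, h6⟩, h7⟩ := hq
    by_cases hy : y = x - e
    · subst hy
      have h8 : x - e - e = x - 2 * e := by omega
      rw [h8] at h6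
      push Not at h6
      refine ⟨x, Finset.mem_filter.2 ⟨h1, h1, by omega, h6.2 (by omega)⟩, ?_⟩
      rw [if_neg h3]
    · have hyx : y = x + e := by
        by_contra h8
        exact h7 ⟨hy, h8⟩
      subst hyx
      have h8 : x + e - 2 * e = x - e := by omega
      have h9 : x + e ∈ S := by
        rcases h4 with h4 | h4
        · omega
        · exact h4.2
      refine ⟨x + e, Finset.mem_filter.2 ⟨h9, h9, by omega, by rwa [h8]⟩, ?_⟩
      rw [Nat.add_sub_cancel, if_pos h1]
  · intro y hy
    obtain ⟨h1, h2, h3⟩ := (Finset.mem_filter.1 hy).2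
    congr 1
    have h5 : y - e - e = y - 2 * e := by omega
    split <;> rename_i h4 <;> ext a <;> simp only [mem_moveBead, h5]
    · have : a = y - e → a ∈ S := fun h => h ▸ h4
      have : a = y - e → a ≠ y := by omega
      have : a = y - 2 * e → a ≠ y := by omega
      tauto
    · have : a = y - e → a ∉ S := fun h => h ▸ h4
      tauto

lemma degParity_eq_lower (k : ℕ) {S : Finset ℕ} (h : 2 ^ k ≤ (partOfBeta S).sum) :
    degParity S = lower (2 ^ k) degParity S := by
  induction k generalizing S with
  | zero =>
    have h0 : partOfBeta S ≠ 0 := by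
      intro h0
      rw [h0] at h
      simp at h
    simp only [pow_zero, lower, degParity]
    rw [degSYT_partOfBeta h0, Nat.cast_sum]
  | succ k ih =>
    rw [pow_succ'] at h ⊢
    rw [← lower_lower (by positivity), ih (by omega)]
    refine Finset.sum_congr rfl fun x hx => ih ?_
    have := (Finset.mem_filter.1 hx).2.sum_partOfBeta_moveBead
    omega

lemma CanMove.moveBead_of_ne {e x y : ℕ} {S : Finset ℕ} (hx : CanMove e S x) (hy : CanMove e S y)
    (h : x ≠ y) : CanMove e (moveBead e x S) y := by
  refine ⟨mem_moveBead.2 (Or.inr ⟨h.symm, hy.1⟩), hy.2.1, fun h1 => ?_⟩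
  have := hx.2.1
  have := hy.2.1
  rcases mem_moveBead.1 h1 with h2 | h2
  · omega
  · exact hy.2.2 h2.2

lemma CanMove.le_sum {e x : ℕ} {S : Finset ℕ} (h : CanMove e S x) : e ≤ (partOfBeta S).sum := by
  have := h.sum_partOfBeta_moveBead
  omega

lemma CanMove.eq_of_sum_lt {e x y : ℕ} {S : Finset ℕ} (hx : CanMove e S x) (hy : CanMove e S y)
    (h : (partOfBeta S).sum < 2 * e) : x = y := by
  by_contra hxy
  have h1 := (hx.moveBead_of_ne hy hxy).le_sum
  have h2 := hx.sum_partOfBeta_moveBead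
  omega

lemma exists_odd_move {k : ℕ} {S : Finset ℕ} (hS : degParity S = 1)
    (h : 2 ^ k ≤ (partOfBeta S).sum) :
    ∃ x, CanMove (2 ^ k) S x ∧ degParity (moveBead (2 ^ k) x S) = 1 := by
  rw [degParity_eq_lower k h] at hS
  obtain ⟨x, hx, h1⟩ := Finset.exists_ne_zero_of_sum_ne_zero (hS ▸ one_ne_zero)
  exact ⟨x, (Finset.mem_filter.1 hx).2, (by revert h1; generalize degParity (moveBead (2 ^ k) x S) = c; revert c; decide)⟩

lemma CanMove.degParity_eq {a x : ℕ} {S : Finset ℕ} (hx : CanMove (2 ^ a) S x)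
    (h : (partOfBeta S).sum < 2 ^ (a + 1)) :
    degParity (moveBead (2 ^ a) x S) = degParity S := by
  rw [degParity_eq_lower a hx.le_sum, lower]
  have : S.filter (CanMove (2 ^ a) S) = {x} := by
    ext y
    simp only [Finset.mem_filter, Finset.mem_singleton]
    constructor
    · rintro ⟨-, hy⟩
      exact hy.eq_of_sum_lt hx (by rwa [← pow_succ'])
    · rintro rfl
      exact ⟨hx.1, hx⟩
  rw [this, Finset.sum_singleton]

/-- Moving a bead by `d` commutes with the removal of a hook of length `E > d` whose removal
leaves no hook of length `E`. -/
lemma exists_move_of_large_move {d E x z w : ℕ} {S : Finset ℕ} (hdE : d < E) (hx : CanMove E S x)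
    (hC : ∀ v, ¬ CanMove E (moveBead E x S) v) (hz : CanMove d S z)
    (hw : CanMove E (moveBead d z S) w)
    (hu : ∀ v, CanMove E (moveBead d z S) v → v = w) :
    ∃ p, CanMove d (moveBead E x S) p ∧
      moveBead d p (moveBead E x S) = moveBead E w (moveBead d z S) ∧
      z = if p = x - E then x else if p = x + d then x - E + d else p := by
  have hd := hz.pos
  obtain ⟨hx1, hx2, hx3⟩ := hx
  obtain ⟨hz1, hz2, hz3⟩ := hz
  by_cases hzx : z = x
  · subst hzx
    obtain ⟨hw1, hw2, hw3⟩ := hw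
    simp only [mem_moveBead] at hw1 hw3
    have hwz : w = z - d := by
      by_contra h1
      have h2 : w ≠ z ∧ w ∈ S := by tauto
      apply hC w
      simp only [CanMove, mem_moveBead]
      push Not at hw3
      refine ⟨Or.inr h2, hw2, ?_⟩
      rintro (h3 | h3)
      · omega
      · exact hw3.2 h3.1 h3.2
    subst hwz
    push Not at hw3
    have h5 : z - d - E = z - E - d := by omega
    refine ⟨z - E, ⟨mem_moveBead.2 (Or.inl rfl), by omega, ?_⟩, ?_, by simp⟩
    · simp only [mem_moveBead]
      rw [h5] at hw3
      rintro (h3 | h3)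
      · omega
      · exact hw3.2 h3.1 h3.2
    · ext b
      have : b = z - E → b ∉ S := fun h => h ▸ hx3
      have : b = z - d → b ∉ S := fun h => h ▸ hz3
      simp only [mem_moveBead, h5]
      tauto
  · by_cases hzy : z - d = x - E
    · obtain ⟨hw1, hw2, hw3⟩ := hw
      simp only [mem_moveBead] at hw1 hw3
      push Not at hw3
      have hwx : w ≠ x := by
        rintro rfl
        exact hw3.1 hzy.symm
      have hwz : w = z + E := by
        by_contra h1
        have h2 : w ≠ z ∧ w ∈ S := by
          rcases hw1 with h2 | h2
          · exfalso
            have h3 : CanMove E (moveBead E x S) (x - E) := by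
              simp only [CanMove, mem_moveBead]
              refine ⟨Or.inl trivial, by omega, ?_⟩
              rw [h2, hzy] at hw3
              rintro (h3 | h3)
              · omega
              · exact hw3.2 (by omega) h3.2
            exact hC _ h3
          · exact h2
        apply hC w
        simp only [CanMove, mem_moveBead]
        refine ⟨Or.inr ⟨hwx, h2.2⟩, hw2, ?_⟩
        rintro (h3 | h3)
        · omega
        · exact hw3.2 (by omega) h3.2
      have hwx' : w = x + d := by omega
      have hzd : z = x - E + d := by omega
      have hwS : w ∈ S := by
        rcases hw1 with h2 | h2
        · omega
        · exact h2.2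
      refine ⟨w, ⟨mem_moveBead.2 (Or.inr ⟨hwx, hwS⟩), by omega, ?_⟩, ?_, ?_⟩
      · simp only [mem_moveBead]
        omega
      · have h6 : w - d = x := by omega
        have h7 : w - E = z := by omega
        ext b
        simp only [mem_moveBead, h6, h7, hzy]
        by_cases hbz : b = z
        · have h8 : b ≠ x := by omega
          have h9 : b ≠ w := by omega
          have h10 : b ∈ S := hbz ▸ hz1
          exact iff_of_true (Or.inr ⟨h9, Or.inr ⟨h8, h10⟩⟩) (Or.inl hbz)
        · by_cases hbx : b = x
          · have h8 : b ≠ w := by omega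
            have h9 : b ∈ S := hbx ▸ hx1
            exact iff_of_true (Or.inl hbx) (Or.inr ⟨h8, Or.inr ⟨hbz, h9⟩⟩)
          · simp only [hbz, hbx, false_or, ne_eq, not_false_eq_true, true_and]
      · rw [if_neg (by omega), if_pos hwx', hzd]
    · have hxw : x = w := by
        apply hu
        refine ⟨mem_moveBead.2 (Or.inr ⟨Ne.symm hzx, hx1⟩), hx2, ?_⟩
        simp only [mem_moveBead]
        rintro (h3 | h3)
        · omega
        · exact hx3 h3.2
      subst hxw
      have hzxd : z ≠ x + d := by
        rintro rfl
        rw [Nat.add_sub_cancel] at hz3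
        exact hz3 hx1
      have hzxE : z ≠ x - E := by
        rintro rfl
        exact hx3 hz1
      refine ⟨z, ⟨mem_moveBead.2 (Or.inr ⟨hzx, hz1⟩), hz2, ?_⟩, ?_, ?_⟩
      · simp only [mem_moveBead]
        rintro (h3 | h3)
        · exact hzy h3
        · exact hz3 h3.2
      · ext b
        simp only [mem_moveBead]
        have : b = z - d → b ≠ x := by
          rintro rfl h
          exact hz3 (h ▸ hx1)
        have : b = x - E → b ≠ z := by omega
        tauto
      · rw [if_neg hzxE, if_neg hzxd]

theorem odd_move_unique {k : ℕ} {S : Finset ℕ} (hS : degParity S = 1) {z z' : ℕ}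
    (hz : CanMove (2 ^ k) S z) (hz' : CanMove (2 ^ k) S z')
    (hg : degParity (moveBead (2 ^ k) z S) = 1) (hg' : degParity (moveBead (2 ^ k) z' S) = 1) :
    z = z' := by
  induction hn : (partOfBeta S).sum using Nat.strong_induction_on generalizing S z z' with
  | _ n ih =>
    have hkn : 2 ^ k ≤ n := hn ▸ hz.le_sum
    have hn0 : n ≠ 0 := by
      have : 0 < 2 ^ k := by positivity
      omega
    obtain ⟨a, ha⟩ : ∃ a, a = Nat.log 2 n := ⟨_, rfl⟩
    have ha1 : 2 ^ a ≤ n := ha ▸ Nat.pow_log_le_self 2 hn0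
    have ha2 : n < 2 ^ (a + 1) := ha ▸ Nat.lt_pow_succ_log_self one_lt_two n
    have hka : k ≤ a := by
      rw [ha]
      exact Nat.le_log_of_pow_le one_lt_two hkn
    have ha3 : n < 2 * 2 ^ a := by rwa [← pow_succ']
    rcases hka.eq_or_lt with rfl | hka
    · exact hz.eq_of_sum_lt hz' (by rwa [hn])
    · have hpow : 2 ^ k < 2 ^ a := Nat.pow_lt_pow_right one_lt_two hka
      obtain ⟨x, hx, hxg⟩ := exists_odd_move hS (by rwa [hn] : 2 ^ a ≤ _)
      have hCs := hx.sum_partOfBeta_moveBead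
      have hC : ∀ v, ¬ CanMove (2 ^ a) (moveBead (2 ^ a) x S) v := fun v hv => by
        have := hv.le_sum
        omega
      by_cases hr : n - 2 ^ a < 2 ^ k
      · by_contra hne
        have key : ∀ v, CanMove (2 ^ k) S v → v = x ∨ v = x - 2 ^ a + 2 ^ k := by
          intro v hv
          by_contra h1
          push Not at h1
          have h2 : CanMove (2 ^ k) (moveBead (2 ^ a) x S) v := by
            refine ⟨mem_moveBead.2 (Or.inr ⟨h1.1, hv.1⟩), hv.2.1, ?_⟩
            have := hv.2.1
            simp only [mem_moveBead]
            rintro (h3 | h3)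
            · omega
            · exact hv.2.2 h3.2
          have := h2.le_sum
          omega
        have hM : S.filter (CanMove (2 ^ k) S) = {z, z'} := by
          ext v
          simp only [Finset.mem_filter, Finset.mem_insert, Finset.mem_singleton]
          constructor
          · rintro ⟨-, hv⟩
            have h1 := key v hv
            have h2 := key z hz
            have h3 := key z' hz'
            omega
          · rintro (rfl | rfl)
            · exact ⟨hz.1, hz⟩
            · exact ⟨hz'.1, hz'⟩
        rw [degParity_eq_lower k hz.le_sum, lower, hM, Finset.sum_pair hne, hg, hg',
          CharTwo.add_self_eq_zero] at hS
        exact zero_ne_one hS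
      · have main : ∀ v, CanMove (2 ^ k) S v → degParity (moveBead (2 ^ k) v S) = 1 →
            ∃ p, CanMove (2 ^ k) (moveBead (2 ^ a) x S) p ∧
              degParity (moveBead (2 ^ k) p (moveBead (2 ^ a) x S)) = 1 ∧
              v = if p = x - 2 ^ a then x else if p = x + 2 ^ k then x - 2 ^ a + 2 ^ k else p := by
          intro v hv hvg
          have hvs := hv.sum_partOfBeta_moveBead
          have hk0 : 0 < 2 ^ k := by positivity
          have hvs1 : 2 ^ a ≤ (partOfBeta (moveBead (2 ^ k) v S)).sum := by omega
          have hvs2 : (partOfBeta (moveBead (2 ^ k) v S)).sum < 2 * 2 ^ a := by omega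
          obtain ⟨w, hw, hwg⟩ := exists_odd_move hvg hvs1
          obtain ⟨p, h1, h2, h3⟩ := exists_move_of_large_move hpow hx hC hv hw
            (fun u hu => hu.eq_of_sum_lt hw hvs2)
          exact ⟨p, h1, by rw [h2, hwg], h3⟩
        obtain ⟨p, hp, hpg, hpz⟩ := main z hz hg
        obtain ⟨p', hp', hpg', hpz'⟩ := main z' hz' hg'
        have : p = p' := ih _ (by omega) hxg hp hp' hpg hpg' rfl
        rw [hpz, hpz', this]

lemma canMove_shift {e x : ℕ} {S : Finset ℕ} :
    CanMove e (shift S) (x + 1) ↔ CanMove e S x := by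
  constructor
  · rintro h
    have he := h.pos
    obtain ⟨h1, h2, h3⟩ := h
    have h4 : e ≤ x := by
      by_contra h4
      rw [show x + 1 - e = 0 by omega] at h3
      exact h3 (zero_mem_shift S)
    refine ⟨succ_mem_shift.1 h1, h4, fun h5 => h3 ?_⟩
    rw [show x + 1 - e = x - e + 1 by omega]
    exact succ_mem_shift.2 h5
  · rintro ⟨h1, h2, h3⟩
    refine ⟨succ_mem_shift.2 h1, by omega, fun h5 => h3 ?_⟩
    rw [show x + 1 - e = x - e + 1 by omega] at h5
    exact succ_mem_shift.1 h5

lemma moveBead_shift {e x : ℕ} {S : Finset ℕ} (h : e ≤ x) :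
    moveBead e (x + 1) (shift S) = shift (moveBead e x S) := by
  ext (_ | b)
  · simp [mem_moveBead, zero_mem_shift]
  · have h1 : b + 1 = x + 1 - e ↔ b = x - e := by omega
    simp only [mem_moveBead, succ_mem_shift, h1, ne_eq, Nat.add_right_cancel_iff]

lemma exists_move_shift {e : ℕ} {S : Finset ℕ} {mu : Multiset ℕ} :
    (∃ x, CanMove e (shift S) x ∧ partOfBeta (moveBead e x (shift S)) = mu) ↔
      ∃ x, CanMove e S x ∧ partOfBeta (moveBead e x S) = mu := by
  constructor
  · rintro ⟨_ | x, hx, h⟩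
    · have := hx.pos
      have := hx.2.1
      omega
    · have hx := canMove_shift.1 hx
      rw [moveBead_shift hx.2.1, partOfBeta_shift] at h
      exact ⟨x, hx, h⟩
  · rintro ⟨x, hx, h⟩
    exact ⟨x + 1, canMove_shift.2 hx, by rw [moveBead_shift hx.2.1, partOfBeta_shift, h]⟩

lemma exists_move_congr {e : ℕ} {S T : Finset ℕ} {mu : Multiset ℕ}
    (h : partOfBeta S = partOfBeta T) :
    (∃ x, CanMove e S x ∧ partOfBeta (moveBead e x S) = mu) ↔
      ∃ x, CanMove e T x ∧ partOfBeta (moveBead e x T) = mu := by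
  have key : ∀ (j : ℕ) (S : Finset ℕ),
      (∃ x, CanMove e (shift^[j] S) x ∧ partOfBeta (moveBead e x (shift^[j] S)) = mu) ↔
        ∃ x, CanMove e S x ∧ partOfBeta (moveBead e x S) = mu := by
    intro j S
    induction j with
    | zero => rfl
    | succ j ih => rw [Function.iterate_succ_apply', exists_move_shift, ih]
  rcases Nat.le_total S.card T.card with hc | hc
  · obtain ⟨j, hj⟩ := Nat.exists_eq_add_of_le hc
    rw [eq_shift_iterate h hj, key]
  · obtain ⟨j, hj⟩ := Nat.exists_eq_add_of_le hc
    rw [eq_shift_iterate h.symm hj, key]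

lemma isHookRemoval_iff {e : ℕ} {S : Finset ℕ} {mu : Multiset ℕ} :
    IsHookRemoval e (partOfBeta S) mu ↔
      ∃ x, CanMove e S x ∧ partOfBeta (moveBead e x S) = mu := by
  constructor
  · rintro ⟨h1, h2, -, m, x, h3, h4, h5, h6, h7, h8⟩
    rw [← exists_move_congr (partOfBeta_betaSet h1 h3)]
    refine ⟨x, ⟨h5, h6, h7⟩, ?_⟩
    rw [moveBead, ← h8, partOfBeta_betaSet h2 h4]
  · rintro ⟨x, hx, rfl⟩
    refine ⟨fun _ => pos_of_mem_partOfBeta, fun _ => pos_of_mem_partOfBeta, hx.pos, S.card, x,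
      card_partOfBeta_le S, ?_, ?_⟩
    · rw [← hx.card_moveBead]
      exact card_partOfBeta_le _
    · rw [betaSet_partOfBeta]
      refine ⟨hx.1, hx.2.1, hx.2.2, ?_⟩
      conv_lhs => rw [← hx.card_moveBead, betaSet_partOfBeta]
      rfl

lemma exists_partOfBeta {lam : Multiset ℕ} (h : ∀ x ∈ lam, 0 < x) : ∃ S, partOfBeta S = lam :=
  ⟨_, partOfBeta_betaSet h le_rfl⟩

lemma IsHookRemoval.sum_add {e : ℕ} {lam mu : Multiset ℕ} (h : IsHookRemoval e lam mu) :
    mu.sum + e = lam.sum := by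
  obtain ⟨S, rfl⟩ := exists_partOfBeta h.1
  obtain ⟨x, hx, rfl⟩ := isHookRemoval_iff.1 h
  exact hx.sum_partOfBeta_moveBead

lemma oddP_partOfBeta {S : Finset ℕ} : OddP (partOfBeta S) ↔ degParity S = 1 := by
  unfold OddP degParity
  rw [ZMod.natCast_eq_one_iff_odd]
  exact ⟨fun h => h.2, fun h => ⟨fun _ => pos_of_mem_partOfBeta, h⟩⟩

lemma exists_fkOp {k : ℕ} {lam : Multiset ℕ} (h : OddP lam) (hk : 2 ^ k ≤ lam.sum) :
    IsHookRemoval (2 ^ k) lam (fkOp k lam) ∧ OddP (fkOp k lam) := by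
  have hex : ∃ mu, IsHookRemoval (2 ^ k) lam mu ∧ OddP mu := by
    obtain ⟨S, rfl⟩ := exists_partOfBeta h.1
    obtain ⟨x, hx, hg⟩ := exists_odd_move (oddP_partOfBeta.1 h) hk
    exact ⟨_, isHookRemoval_iff.2 ⟨x, hx, rfl⟩, oddP_partOfBeta.2 hg⟩
  rw [fkOp, dif_pos hex]
  exact hex.choose_spec

lemma eq_fkOp {k : ℕ} {lam mu : Multiset ℕ} (h : OddP lam) (h1 : IsHookRemoval (2 ^ k) lam mu)
    (h2 : OddP mu) : mu = fkOp k lam := by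
  have hk : 2 ^ k ≤ lam.sum := by
    have := h1.sum_add
    omega
  obtain ⟨h3, h4⟩ := exists_fkOp h hk
  generalize fkOp k lam = nu at h3 h4
  obtain ⟨S, rfl⟩ := exists_partOfBeta h.1
  obtain ⟨x, hx, rfl⟩ := isHookRemoval_iff.1 h1
  obtain ⟨y, hy, rfl⟩ := isHookRemoval_iff.1 h3
  rw [odd_move_unique (oddP_partOfBeta.1 h) hx hy (oddP_partOfBeta.1 h2) (oddP_partOfBeta.1 h4)]

lemma IsHookRemoval.oddP_iff {a : ℕ} {lam mu : Multiset ℕ} (h : IsHookRemoval (2 ^ a) lam mu)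
    (hs : mu.sum < 2 ^ a) : OddP mu ↔ OddP lam := by
  have h1 := h.sum_add
  obtain ⟨S, rfl⟩ := exists_partOfBeta h.1
  obtain ⟨x, hx, rfl⟩ := isHookRemoval_iff.1 h
  rw [oddP_partOfBeta, oddP_partOfBeta, hx.degParity_eq (by rw [pow_succ]; omega)]

/-- The beads of `S` in positions congruent to `r` modulo two, as positions on their runner. -/
def runner (r : ℕ) (S : Finset ℕ) : Finset ℕ :=
  (S.filter (fun b => b % 2 = r)).image (fun b => b / 2)

lemma mem_runner {r c : ℕ} (hr : r < 2) {S : Finset ℕ} : c ∈ runner r S ↔ 2 * c + r ∈ S := by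
  simp only [runner, Finset.mem_image, Finset.mem_filter]
  constructor
  · rintro ⟨b, ⟨h1, h2⟩, rfl⟩
    rwa [← h2, Nat.div_add_mod]
  · intro h
    exact ⟨2 * c + r, ⟨h, by omega⟩, by omega⟩

lemma card_runner (r : ℕ) (S : Finset ℕ) :
    (runner r S).card = (S.filter (fun b => b % 2 = r)).card := by
  refine Finset.card_image_of_injOn ?_
  intro x hx y hy hxy
  simp only [Finset.coe_filter, Set.mem_ofPred_eq] at hx hy hxy
  omega

lemma card_runner_add (S : Finset ℕ) : (runner 0 S).card + (runner 1 S).card = S.card := by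
  rw [card_runner, card_runner, ← Finset.card_filter_add_card_filter_not (s := S) (fun b => b % 2 = 0)]
  congr 3
  ext b
  omega

lemma runner_ext {S T : Finset ℕ} (h : ∀ r < 2, runner r S = runner r T) : S = T := by
  ext b
  have h1 : b % 2 < 2 := Nat.mod_lt _ two_pos
  have h2 := mem_runner h1 (c := b / 2) (S := S)
  have h3 := mem_runner h1 (c := b / 2) (S := T)
  rw [Nat.div_add_mod] at h2 h3
  rw [← h2, ← h3, h _ h1]

lemma runner_shift_shift {r : ℕ} (hr : r < 2) (S : Finset ℕ) :
    runner r (shift (shift S)) = shift (runner r S) := by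
  ext (_ | c)
  · rw [mem_runner hr]
    refine iff_of_true ?_ (zero_mem_shift _)
    interval_cases r
    · exact zero_mem_shift _
    · exact succ_mem_shift.2 (zero_mem_shift _)
  · rw [mem_runner hr, succ_mem_shift, mem_runner hr,
      show 2 * (c + 1) + r = 2 * c + r + 1 + 1 by omega, succ_mem_shift, succ_mem_shift]

lemma runner_shift_iterate {r : ℕ} (hr : r < 2) (S : Finset ℕ) (j : ℕ) :
    runner r (shift^[2 * j] S) = shift^[j] (runner r S) := by
  induction j with
  | zero => rfl
  | succ j ih =>
    rw [show 2 * (j + 1) = 2 * j + 1 + 1 by ring, Function.iterate_succ_apply',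
      Function.iterate_succ_apply', runner_shift_shift hr, ih, Function.iterate_succ_apply']

/-- The excess of beads on the even runner, which determines the `2`-core. -/
def coreExcess (lam : Multiset ℕ) : ℤ :=
  ((runner 0 (betaSet lam (2 * Multiset.card lam))).card : ℤ) - Multiset.card lam

lemma runner_normalize {S : Finset ℕ} (h : Even S.card) :
    ∃ j, S.card = 2 * (Multiset.card (partOfBeta S) + j) ∨
      S.card + 2 * j = 2 * Multiset.card (partOfBeta S) := by
  obtain ⟨m, hm⟩ := h
  rcases Nat.le_total (Multiset.card (partOfBeta S)) m with h1 | h1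
  · exact ⟨m - Multiset.card (partOfBeta S), Or.inl (by omega)⟩
  · exact ⟨Multiset.card (partOfBeta S) - m, Or.inr (by omega)⟩

lemma quot2_partOfBeta {S : Finset ℕ} (h : Even S.card) :
    quot2 (partOfBeta S) = (partOfBeta (runner 0 S), partOfBeta (runner 1 S)) ∧
      coreExcess (partOfBeta S) = ((runner 0 S).card : ℤ) - (S.card / 2 : ℕ) := by
  set T := betaSet (partOfBeta S) (2 * Multiset.card (partOfBeta S)) with hT
  have hTc : T.card = 2 * Multiset.card (partOfBeta S) := card_betaSet _ _
  have hTS : partOfBeta T = partOfBeta S :=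
    partOfBeta_betaSet (fun _ => pos_of_mem_partOfBeta) (by omega)
  have h1 : quot2 (partOfBeta S) = (partOfBeta (runner 0 T), partOfBeta (runner 1 T)) := rfl
  have h2 : coreExcess (partOfBeta S) =
      ((runner 0 T).card : ℤ) - Multiset.card (partOfBeta S) := rfl
  rw [h1, h2]
  obtain ⟨j, hj | hj⟩ := runner_normalize h
  · have h3 : S = shift^[2 * j] T := eq_shift_iterate hTS (by omega)
    have h4 := runner_shift_iterate (r := 0) (by omega) T j
    have h5 := runner_shift_iterate (r := 1) (by omega) T j
    rw [← h3] at h4 h5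
    rw [h4, h5, partOfBeta_shift_iterate, partOfBeta_shift_iterate, card_shift_iterate]
    exact ⟨rfl, by push_cast; omega⟩
  · have h3 : T = shift^[2 * j] S := eq_shift_iterate hTS.symm (by omega)
    have h4 := runner_shift_iterate (r := 0) (by omega) S j
    have h5 := runner_shift_iterate (r := 1) (by omega) S j
    rw [← h3] at h4 h5
    rw [h4, h5, partOfBeta_shift_iterate, partOfBeta_shift_iterate, card_shift_iterate]
    exact ⟨rfl, by push_cast; omega⟩

lemma exists_even_partOfBeta {lam : Multiset ℕ} (h : ∀ x ∈ lam, 0 < x) {m : ℕ}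
    (hm : Multiset.card lam ≤ m) : ∃ S, partOfBeta S = lam ∧ S.card = 2 * m :=
  ⟨betaSet lam (2 * m), partOfBeta_betaSet h (by omega), card_betaSet _ _⟩

lemma eq_of_quot2_eq {lam mu : Multiset ℕ} (hl : ∀ x ∈ lam, 0 < x) (hmu : ∀ x ∈ mu, 0 < x)
    (h : quot2 lam = quot2 mu) (hc : coreExcess lam = coreExcess mu) : lam = mu := by
  obtain ⟨m, hm⟩ : ∃ m, m = max (Multiset.card lam) (Multiset.card mu) := ⟨_, rfl⟩
  obtain ⟨S, rfl, hS⟩ := exists_even_partOfBeta hl (show _ ≤ m by omega)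
  obtain ⟨T, rfl, hT⟩ := exists_even_partOfBeta hmu (show _ ≤ m by omega)
  obtain ⟨h1, h2⟩ := quot2_partOfBeta (hS ▸ even_two_mul m : Even S.card)
  obtain ⟨h3, h4⟩ := quot2_partOfBeta (hT ▸ even_two_mul m : Even T.card)
  rw [h1, h3, Prod.mk.injEq] at h
  rw [h2, h4, hS, hT] at hc
  have h5 := card_runner_add S
  have h6 := card_runner_add T
  congr 1
  refine runner_ext fun r hr => ?_
  interval_cases r
  · exact partOfBeta_injective (by omega) h.1
  · exact partOfBeta_injective (by omega) h.2

lemma canMove_runner {r e x : ℕ} (hr : r < 2) {S : Finset ℕ} :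
    CanMove e (runner r S) x ↔ CanMove (2 * e) S (2 * x + r) := by
  simp only [CanMove, mem_runner hr]
  constructor
  · rintro ⟨h1, h2, h3⟩
    exact ⟨h1, by omega, by rwa [show 2 * x + r - 2 * e = 2 * (x - e) + r by omega]⟩
  · rintro ⟨h1, h2, h3⟩
    have h4 : e ≤ x := by omega
    exact ⟨h1, h4, by rwa [show 2 * x + r - 2 * e = 2 * (x - e) + r by omega] at h3⟩

lemma runner_moveBead {r e x : ℕ} (hr : r < 2) {S : Finset ℕ} (h : e ≤ x) :
    runner r (moveBead (2 * e) (2 * x + r) S) = moveBead e x (runner r S) := by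
  ext c
  simp only [mem_moveBead, mem_runner hr]
  have h1 : 2 * c + r = 2 * x + r - 2 * e ↔ c = x - e := by omega
  have h2 : 2 * c + r = 2 * x + r ↔ c = x := by omega
  simp only [h1, ne_eq, h2]

lemma runner_moveBead_of_ne {r r' e x : ℕ} (hr : r < 2) (hr' : r' < 2) (hne : r' ≠ r)
    {S : Finset ℕ} (h : e ≤ x) :
    runner r' (moveBead (2 * e) (2 * x + r) S) = runner r' S := by
  ext c
  simp only [mem_moveBead, mem_runner hr']
  have h1 : 2 * c + r' ≠ 2 * x + r - 2 * e := by omega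
  have h2 : 2 * c + r' ≠ 2 * x + r := by omega
  simp only [h1, ne_eq, h2, false_or, not_false_eq_true, true_and]

/-- The component of the `2`-quotient with index `r`. -/
def quotComp (r : ℕ) (lam : Multiset ℕ) : Multiset ℕ :=
  if r = 0 then (quot2 lam).1 else (quot2 lam).2

lemma quotComp_partOfBeta {r : ℕ} (hr : r < 2) {S : Finset ℕ} (h : Even S.card) :
    quotComp r (partOfBeta S) = partOfBeta (runner r S) := by
  unfold quotComp
  rw [(quot2_partOfBeta h).1]
  interval_cases r <;> rfl

lemma pos_of_mem_quotComp {r p : ℕ} {lam : Multiset ℕ} (h : p ∈ quotComp r lam) : 0 < p := by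
  unfold quotComp quot2 at h
  split at h <;> dsimp only at h <;> exact pos_of_mem_partOfBeta h

lemma coreExcess_moveBead {r e x : ℕ} {S : Finset ℕ} (hr : r < 2) (h : Even S.card)
    (hx : CanMove e (runner r S) x) :
    coreExcess (partOfBeta (moveBead (2 * e) (2 * x + r) S)) = coreExcess (partOfBeta S) := by
  have hx' := (canMove_runner hr).1 hx
  rw [(quot2_partOfBeta h).2, (quot2_partOfBeta (by rwa [hx'.card_moveBead])).2,
    hx'.card_moveBead]
  by_cases h0 : r = 0
  · subst h0
    rw [runner_moveBead hr hx.2.1, hx.card_moveBead]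
  · rw [runner_moveBead_of_ne hr two_pos (Ne.symm h0) hx.2.1]

lemma IsHookRemoval.exists_quotComp {e : ℕ} {lam mu : Multiset ℕ}
    (h : IsHookRemoval (2 * e) lam mu) :
    coreExcess mu = coreExcess lam ∧ ∃ r < 2,
      IsHookRemoval e (quotComp r lam) (quotComp r mu) ∧
      ∀ r' < 2, r' ≠ r → quotComp r' mu = quotComp r' lam := by
  obtain ⟨S, rfl, hS⟩ := exists_even_partOfBeta h.1 le_rfl
  have hE : Even S.card := hS ▸ even_two_mul _
  obtain ⟨x, hx, rfl⟩ := isHookRemoval_iff.1 h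
  have hE' : Even (moveBead (2 * e) x S).card := by rwa [hx.card_moveBead]
  obtain ⟨y, r, hr, rfl⟩ : ∃ y r, r < 2 ∧ x = 2 * y + r :=
    ⟨x / 2, x % 2, Nat.mod_lt _ two_pos, (Nat.div_add_mod _ _).symm⟩
  have hy := (canMove_runner hr).2 hx
  refine ⟨coreExcess_moveBead hr hE hy, r, hr, ?_, ?_⟩
  · rw [quotComp_partOfBeta hr hE, quotComp_partOfBeta hr hE', isHookRemoval_iff]
    exact ⟨y, hy, by rw [runner_moveBead hr hy.2.1]⟩
  · intro r' hr' hne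
    rw [quotComp_partOfBeta hr' hE, quotComp_partOfBeta hr' hE',
      runner_moveBead_of_ne hr hr' hne hy.2.1]

lemma exists_isHookRemoval_of_quotComp {e r : ℕ} {lam rho : Multiset ℕ} (hr : r < 2)
    (hl : ∀ x ∈ lam, 0 < x) (h : IsHookRemoval e (quotComp r lam) rho) :
    ∃ mu, IsHookRemoval (2 * e) lam mu ∧ quotComp r mu = rho ∧
      ∀ r' < 2, r' ≠ r → quotComp r' mu = quotComp r' lam := by
  obtain ⟨S, rfl, hS⟩ := exists_even_partOfBeta hl le_rfl
  have hE : Even S.card := hS ▸ even_two_mul _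
  rw [quotComp_partOfBeta hr hE] at h
  obtain ⟨y, hy, rfl⟩ := isHookRemoval_iff.1 h
  have hx := (canMove_runner hr).1 hy
  have hE' : Even (moveBead (2 * e) (2 * y + r) S).card := by rwa [hx.card_moveBead]
  refine ⟨_, isHookRemoval_iff.2 ⟨_, hx, rfl⟩, ?_, ?_⟩
  · rw [quotComp_partOfBeta hr hE', runner_moveBead hr hy.2.1]
  · intro r' hr' hne
    rw [quotComp_partOfBeta hr' hE, quotComp_partOfBeta hr' hE',
      runner_moveBead_of_ne hr hr' hne hy.2.1]

lemma length_towerRow (k : ℕ) (lam : Multiset ℕ) : (towerRow k lam).length = 2 ^ k := by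
  induction k with
  | zero => rfl
  | succ k ih =>
    rw [towerRow, List.length_flatMap]
    simp [ih, pow_succ]

lemma getD_flatMap_pair {α β : Type*} (f g : α → β) (L : List α) (a : α) (b : β) {s r : ℕ}
    (hr : r < 2) (hs : s < L.length) :
    (L.flatMap (fun x => [f x, g x])).getD (2 * s + r) b =
      if r = 0 then f (L.getD s a) else g (L.getD s a) := by
  induction L generalizing s with
  | nil => simp at hs
  | cons x L ih =>
    rw [List.flatMap_cons]
    cases s with
    | zero => interval_cases r <;> simp
    | succ s =>
      rw [show 2 * (s + 1) + r = 2 * s + r + 1 + 1 by ring]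
      simp only [List.cons_append, List.nil_append, List.getD_cons_succ]
      exact ih (by simpa using hs)

/-- The component with index `s` of row `k` of the `2`-quotient tower. -/
def towerComp (k s : ℕ) (lam : Multiset ℕ) : Multiset ℕ := (towerRow k lam).getD s 0

lemma towerComp_succ {k s r : ℕ} (hr : r < 2) (hs : s < 2 ^ k) (lam : Multiset ℕ) :
    towerComp (k + 1) (2 * s + r) lam = quotComp r (towerComp k s lam) := by
  unfold towerComp quotComp
  rw [towerRow, getD_flatMap_pair _ _ _ 0 _ hr (by rwa [length_towerRow])]

lemma exists_index_succ {k i : ℕ} (h : i < 2 ^ (k + 1)) :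
    ∃ s r, s < 2 ^ k ∧ r < 2 ∧ i = 2 * s + r := by
  rw [pow_succ] at h
  exact ⟨i / 2, i % 2, by omega, by omega, by omega⟩

lemma pos_of_mem_towerComp {k s p : ℕ} {lam : Multiset ℕ} (hl : ∀ x ∈ lam, 0 < x)
    (hs : s < 2 ^ k) (h : p ∈ towerComp k s lam) : 0 < p := by
  cases k with
  | zero =>
    obtain rfl : s = 0 := by simpa using hs
    exact hl p h
  | succ k =>
    obtain ⟨t, r, ht, hr, rfl⟩ := exists_index_succ hs
    rw [towerComp_succ hr ht] at h
    exact pos_of_mem_quotComp h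

lemma getD_set_towerRow {k s i : ℕ} (hs : s < 2 ^ k) (lam rho : Multiset ℕ) :
    ((towerRow k lam).set s rho).getD i 0 = if i = s then rho else towerComp k i lam := by
  unfold towerComp
  split <;> rename_i h
  · subst h
    rw [List.getD_eq_getElem _ _ (by rwa [List.length_set, length_towerRow]), List.getElem_set_self]
  · rw [List.getD_eq_getElem?_getD, List.getD_eq_getElem?_getD, List.getElem?_set_ne (Ne.symm h)]

lemma towerRow_eq_set {k s : ℕ} {lam mu : Multiset ℕ} (hs : s < 2 ^ k)
    (h : ∀ i < 2 ^ k, i ≠ s → towerComp k i mu = towerComp k i lam) :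
    towerRow k mu = (towerRow k lam).set s (towerComp k s mu) := by
  refine List.ext_getElem (by rw [List.length_set, length_towerRow, length_towerRow]) ?_
  intro i h1 h2
  rw [← List.getD_eq_getElem _ 0 h1, ← List.getD_eq_getElem _ 0 h2, getD_set_towerRow hs]
  rw [length_towerRow] at h1
  split <;> rename_i hi
  · rw [hi]
    rfl
  · exact h i h1 hi

lemma IsHookRemoval.exists_towerComp {k e : ℕ} {lam mu : Multiset ℕ}
    (h : IsHookRemoval (2 ^ k * e) lam mu) :
    ∃ s < 2 ^ k, IsHookRemoval e (towerComp k s lam) (towerComp k s mu) ∧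
      (∀ i < 2 ^ k, i ≠ s → towerComp k i mu = towerComp k i lam) ∧
      ∀ j < k, ∀ i < 2 ^ j, coreExcess (towerComp j i mu) = coreExcess (towerComp j i lam) := by
  induction k generalizing e with
  | zero =>
    refine ⟨0, by simp, by rw [pow_zero, one_mul] at h; exact h, fun i hi hi0 => ?_, by simp⟩
    simp at hi
    omega
  | succ k ih =>
    rw [pow_succ, mul_assoc] at h
    obtain ⟨s, hs, h1, h2, h3⟩ := ih h
    obtain ⟨hc, r, hr, h4, h5⟩ := h1.exists_quotComp
    refine ⟨2 * s + r, by rw [pow_succ]; omega, ?_, ?_, ?_⟩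
    · rwa [towerComp_succ hr hs, towerComp_succ hr hs]
    · intro i hi hne
      obtain ⟨t, r', ht, hr', rfl⟩ := exists_index_succ hi
      rw [towerComp_succ hr' ht, towerComp_succ hr' ht]
      by_cases hts : t = s
      · subst hts
        exact h5 r' hr' (by omega)
      · rw [h2 t ht hts]
    · intro j hj i hi
      rcases Nat.lt_succ_iff_lt_or_eq.1 hj with hj | rfl
      · exact h3 j hj i hi
      · by_cases his : i = s
        · rw [his, hc]
        · rw [h2 i hi his]

lemma exists_isHookRemoval_of_towerComp {k e s : ℕ} {lam rho : Multiset ℕ} (hs : s < 2 ^ k)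
    (hl : ∀ x ∈ lam, 0 < x) (h : IsHookRemoval e (towerComp k s lam) rho) :
    ∃ mu, IsHookRemoval (2 ^ k * e) lam mu ∧ towerComp k s mu = rho ∧
      ∀ i < 2 ^ k, i ≠ s → towerComp k i mu = towerComp k i lam := by
  induction k generalizing e s rho with
  | zero =>
    obtain rfl : s = 0 := by simpa using hs
    refine ⟨rho, by rw [pow_zero, one_mul]; exact h, rfl, fun i hi hi0 => ?_⟩
    simp at hi
    omega
  | succ k ih =>
    obtain ⟨t, r, ht, hr, rfl⟩ := exists_index_succ hs
    rw [towerComp_succ hr ht] at h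
    obtain ⟨nu, h1, h2, h3⟩ :=
      exists_isHookRemoval_of_quotComp hr (fun _ => pos_of_mem_towerComp hl ht) h
    obtain ⟨mu, h4, h5, h6⟩ := ih ht h1
    refine ⟨mu, by rwa [pow_succ, mul_assoc], by rw [towerComp_succ hr ht, h5, h2], ?_⟩
    intro i hi hne
    obtain ⟨t', r', ht', hr', rfl⟩ := exists_index_succ hi
    rw [towerComp_succ hr' ht', towerComp_succ hr' ht']
    by_cases htt : t' = t
    · subst htt
      rw [h5, h3 r' hr' (by omega)]
    · rw [h6 t' ht' htt]

lemma eq_of_towerComp_eq {k : ℕ} {lam mu : Multiset ℕ} (hl : ∀ x ∈ lam, 0 < x)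
    (hm : ∀ x ∈ mu, 0 < x) (h : ∀ i < 2 ^ k, towerComp k i lam = towerComp k i mu)
    (hc : ∀ j < k, ∀ i < 2 ^ j, coreExcess (towerComp j i lam) = coreExcess (towerComp j i mu)) :
    lam = mu := by
  induction k with
  | zero => exact h 0 (by simp)
  | succ k ih =>
    refine ih (fun i hi => ?_) (fun j hj => hc j (by omega))
    refine eq_of_quot2_eq (fun _ => pos_of_mem_towerComp hl hi)
      (fun _ => pos_of_mem_towerComp hm hi) ?_ (hc k (by omega) i hi)
    have h0 := h (2 * i + 0) (by rw [pow_succ]; omega)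
    have h1 := h (2 * i + 1) (by rw [pow_succ]; omega)
    rw [towerComp_succ (by omega) hi, towerComp_succ (by omega) hi] at h0 h1
    exact Prod.ext h0 h1

lemma exists_isHookRemoval_one {lam : Multiset ℕ} (hl : ∀ x ∈ lam, 0 < x) (h : lam ≠ 0) :
    ∃ mu, IsHookRemoval 1 lam mu := by
  obtain ⟨S, rfl⟩ := exists_partOfBeta hl
  obtain ⟨p, hp⟩ := Multiset.exists_mem_of_ne_zero h
  obtain ⟨x, hx, -⟩ := exists_canMove_one hp
  exact ⟨_, isHookRemoval_iff.2 ⟨x, hx, rfl⟩⟩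

lemma oddP_zero : OddP 0 := by
  refine ⟨by simp, ?_⟩
  rw [degSYT, dif_pos rfl]
  exact odd_one

lemma OddP.towerComp_aux {k : ℕ} {lam : Multiset ℕ} (h : OddP lam) :
    (∀ s < 2 ^ k, OddP (towerComp k s lam)) ∧
      ∀ s < 2 ^ k, ∀ t < 2 ^ k, s ≠ t → towerComp k s lam = towerComp k t lam →
        towerComp k s lam = 0 := by
  induction hn : lam.sum using Nat.strong_induction_on generalizing lam with
  | _ n ih =>
    by_cases hkn : n < 2 ^ k
    · have h0 : ∀ s < 2 ^ k, towerComp k s lam = 0 := by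
        intro s hs
        by_contra hne
        obtain ⟨rho, hrho⟩ :=
          exists_isHookRemoval_one (fun _ => pos_of_mem_towerComp h.1 hs) hne
        obtain ⟨mu, hmu, -⟩ := exists_isHookRemoval_of_towerComp hs h.1 hrho
        have := hmu.sum_add
        omega
      exact ⟨fun s hs => h0 s hs ▸ oddP_zero, fun s hs _ _ _ _ => h0 s hs⟩
    · have hk0 : 0 < 2 ^ k := by positivity
      have hn0 : n ≠ 0 := by omega
      obtain ⟨a, ha⟩ : ∃ a, a = Nat.log 2 n := ⟨_, rfl⟩
      have ha1 : 2 ^ a ≤ n := ha ▸ Nat.pow_log_le_self 2 hn0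
      have ha2 : n < 2 ^ (a + 1) := ha ▸ Nat.lt_pow_succ_log_self one_lt_two n
      have hka : k ≤ a := by
        rw [ha]
        exact Nat.le_log_of_pow_le one_lt_two (by omega)
      rw [pow_succ] at ha2
      obtain ⟨h1, h2⟩ := exists_fkOp h (by rwa [hn] : 2 ^ a ≤ _)
      have h1s := h1.sum_add
      have hpow : 2 ^ a = 2 ^ k * 2 ^ (a - k) := by rw [← pow_add, Nat.add_sub_cancel' hka]
      have ha0 : 0 < 2 ^ a := by positivity
      obtain ⟨ih1, ih2⟩ := ih _ (by omega) h2 rfl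
      have hsmall : ∀ s < 2 ^ k, (towerComp k s (fkOp a lam)).sum < 2 ^ (a - k) := by
        intro s hs
        by_contra hge
        obtain ⟨h3, -⟩ := exists_fkOp (ih1 s hs) (not_lt.1 hge)
        obtain ⟨nu, hnu, -⟩ := exists_isHookRemoval_of_towerComp hs h2.1 h3
        have := hnu.sum_add
        omega
      rw [hpow] at h1
      obtain ⟨s, hs, h3, h4, -⟩ := h1.exists_towerComp
      have h3s := h3.sum_add
      have hb : 0 < 2 ^ (a - k) := by positivity
      constructor
      · intro t ht
        by_cases hts : t = s
        · subst hts
          exact (h3.oddP_iff (hsmall t ht)).1 (ih1 t ht)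
        · rw [← h4 t ht hts]
          exact ih1 t ht
      · intro t ht u hu htu heq
        by_cases hts : t = s
        · subst hts
          have h5 := hsmall u hu
          rw [h4 u hu (Ne.symm htu), ← heq] at h5
          omega
        · by_cases hus : u = s
          · subst hus
            have h5 := hsmall t ht
            rw [h4 t ht htu, heq] at h5
            omega
          · rw [← h4 t ht hts, ← h4 u hu hus] at heq
            rw [← h4 t ht hts]
            exact ih2 t ht u hu htu heq

lemma OddP.towerComp {k s : ℕ} {lam : Multiset ℕ} (h : OddP lam) (hs : s < 2 ^ k) :
    OddP (towerComp k s lam) :=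
  h.towerComp_aux.1 s hs

lemma OddP.towerComp_injective {k s t : ℕ} {lam : Multiset ℕ} (h : OddP lam) (hs : s < 2 ^ k)
    (ht : t < 2 ^ k) (heq : OddSym.towerComp k s lam = OddSym.towerComp k t lam)
    (h0 : OddSym.towerComp k s lam ≠ 0) : s = t := by
  by_contra hst
  exact h0 (h.towerComp_aux.2 s hs t ht hst heq)

/-- The passage from an odd partition to its image under `fkOp j`, seen in row `k ≤ j` of the
`2`-quotient tower. -/
lemma exists_Rcomp_eq {k j : ℕ} {lam : Multiset ℕ} (h : OddP lam) (hkj : k ≤ j)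
    (hj : 2 ^ j ≤ lam.sum) :
    ∃ s < 2 ^ k, Rcomp k j lam = towerComp k s lam ∧
      IsHookRemoval (2 ^ (j - k)) (towerComp k s lam) (towerComp k s (fkOp j lam)) ∧
      towerComp k s (fkOp j lam) = fkOp (j - k) (towerComp k s lam) ∧
      (∀ i < 2 ^ k, i ≠ s → towerComp k i (fkOp j lam) = towerComp k i lam) ∧
      ∀ j' < k, ∀ i < 2 ^ j',
        coreExcess (towerComp j' i (fkOp j lam)) = coreExcess (towerComp j' i lam) := by
  obtain ⟨h1, h2⟩ := exists_fkOp h hj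
  have h1' := h1
  rw [← Nat.add_sub_cancel' hkj, pow_add, Nat.add_sub_cancel' hkj] at h1'
  obtain ⟨s, hs, h3, h4, h5⟩ := h1'.exists_towerComp
  have h6 : towerComp k s (fkOp j lam) = fkOp (j - k) (towerComp k s lam) :=
    eq_fkOp (h.towerComp hs) h3 (h2.towerComp hs)
  refine ⟨s, hs, ?_, h3, h6, h4, h5⟩
  have hex : ∃ s, s < 2 ^ k ∧ towerRow k (fkOp j lam) =
      (towerRow k lam).set s (fkOp (j - k) ((towerRow k lam).getD s 0)) := by
    refine ⟨s, hs, ?_⟩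
    rw [towerRow_eq_set hs h4, h6]
    rfl
  rw [Rcomp, dif_pos hex]
  obtain ⟨ht, ht'⟩ := hex.choose_spec
  have hts : hex.choose = s := by
    by_contra hne
    have h7 := congrArg (fun L => L.getD s 0) ht'
    simp only [getD_set_towerRow ht, if_neg (Ne.symm hne)] at h7
    have h8 : towerComp k s (fkOp j lam) = towerComp k s lam := h7
    have h9 := h3.sum_add
    have : 0 < 2 ^ (j - k) := by positivity
    rw [h8] at h9
    omega
  rw [hts]
  rfl

theorem stmt17 (k l n : ℕ) (hkl : k < l) (h : 2 ^ k + 2 ^ l ≤ n)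
    (lam : Multiset ℕ) (hodd : OddP lam) (hsum : lam.sum = n)
    (heq : Rcomp k k lam = Rcomp k l lam) :
    fkOp k (fkOp l lam) = fkOp l (fkOp k lam) ↔
      (Rcomp k k (fkOp l lam) = fkOp (l - k) (Rcomp k k lam) ∧
        fkOp 0 (fkOp (l - k) (Rcomp k k lam)) =
          fkOp (l - k) (fkOp 0 (Rcomp k k lam))) := by
  have hE : 2 ≤ 2 ^ (l - k) := by
    calc 2 = 2 ^ 1 := rfl
      _ ≤ 2 ^ (l - k) := Nat.pow_le_pow_right two_pos (by omega)
  have hk0 : 0 < 2 ^ k := by positivity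
  have hl0 : 0 < 2 ^ l := by positivity
  have hpow : 2 ^ l = 2 ^ k * 2 ^ (l - k) := by rw [← pow_add, Nat.add_sub_cancel' hkl.le]
  obtain ⟨hk1, hk2⟩ := exists_fkOp hodd (by omega : 2 ^ k ≤ lam.sum)
  obtain ⟨hl1, hl2⟩ := exists_fkOp hodd (by omega : 2 ^ l ≤ lam.sum)
  have hk1s := hk1.sum_add
  have hl1s := hl1.sum_add
  obtain ⟨hkl1, hkl2⟩ := exists_fkOp hl2 (by omega : 2 ^ k ≤ (fkOp l lam).sum)
  obtain ⟨s, hs, hRs, hs1, hs2, hs3, hs4⟩ :=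
    exists_Rcomp_eq hodd le_rfl (by omega : 2 ^ k ≤ lam.sum)
  obtain ⟨s', hs', hRs', hs1', hs2', hs3', hs4'⟩ :=
    exists_Rcomp_eq hodd hkl.le (by omega : 2 ^ l ≤ lam.sum)
  obtain ⟨t, ht, hRt, ht1, ht2, ht3, ht4⟩ :=
    exists_Rcomp_eq hl2 le_rfl (by omega : 2 ^ k ≤ (fkOp l lam).sum)
  obtain ⟨u, hu, -, hu1, hu2, hu3, hu4⟩ :=
    exists_Rcomp_eq hk2 hkl.le (by omega : 2 ^ l ≤ (fkOp k lam).sum)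
  rw [Nat.sub_self, pow_zero] at hs1 ht1
  rw [Nat.sub_self] at hs2 ht2
  have hs1s := hs1.sum_add
  have hs1s' := hs1'.sum_add
  have ht1s := ht1.sum_add
  have hu1s := hu1.sum_add
  obtain rfl : s = s' := by
    refine hodd.towerComp_injective hs hs' (by rw [← hRs, heq, hRs']) fun h0 => ?_
    rw [h0, Multiset.sum_zero] at hs1s
    omega
  rw [hRs, hRt, ← hs2, ← hs2']
  constructor
  · intro hcomm
    have hcs := congrArg (towerComp k s) hcomm
    obtain rfl : s = t := by
      by_contra hst
      rw [ht3 s hs hst] at hcs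
      by_cases hsu : s = u
      · subst hsu
        rw [← hcs] at hu1s
        omega
      · rw [hu3 s hs hsu] at hcs
        rw [hcs] at hs1s'
        omega
    obtain rfl : s = u := by
      by_contra hsu
      rw [hu3 s hs hsu] at hcs
      rw [hcs] at ht1s
      omega
    exact ⟨rfl, by rw [← ht2, hcs, hu2]⟩
  · rintro ⟨hR, hcomm⟩
    obtain rfl : t = s := by
      refine hl2.towerComp_injective ht hs hR fun h0 => ?_
      rw [h0, Multiset.sum_zero] at ht1s
      omega
    rw [← ht2] at hcomm
    have hmu : IsHookRemoval (2 ^ (l - k)) (towerComp k t (fkOp k lam))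
        (towerComp k t (fkOp k (fkOp l lam))) := by
      rw [hcomm]
      exact (exists_fkOp (hk2.towerComp hs) (by omega)).1
    obtain ⟨nu, hnu1, hnu2, hnu3⟩ := exists_isHookRemoval_of_towerComp hs hk2.1 hmu
    obtain ⟨-, -, -, -, hnu4⟩ := hnu1.exists_towerComp
    have hnu : fkOp k (fkOp l lam) = nu := by
      refine eq_of_towerComp_eq (k := k) hkl2.1 hnu1.2.1 (fun i hi => ?_) (fun j hj i hi => ?_)
      · by_cases hit : i = t
        · rw [hit, hnu2]
        · rw [hnu3 i hi hit, hs3 i hi hit, ht3 i hi hit, hs3' i hi hit]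
      · rw [hnu4 j hj i hi, hs4 j hj i hi, ht4 j hj i hi, hs4' j hj i hi]
    rw [← hpow] at hnu1
    exact eq_fkOp hk2 (hnu ▸ hnu1) hkl2

end OddSym
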